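/- Let Y ~ N(theta, sigma^2 I_n) with theta in R^n and sigma^2 > 0, and let omega ~ N(0, sigma^2 I_n). Let g : R^n -> R^n be measurable. Assume: (i) there is a measurable function h : R^n -> R such that h(y) = lim_{alpha -> 0} (2/sqrt(alpha)) * E[ <omega, g(y + sqrt(alpha) omega)> ] for Lebesgue-almost every y in R^n; (ii) there exist beta > 0 and a measurable function H : R^n -> R with E[H(Y)] < infinity such that (4/alpha) * ( E[ <omega, g(y + sqrt(alpha) omega)> ] )^2 <= H(y) for almost every y and all alpha in (0, beta]; and (iii) E||g(Y_beta)||_2^4 < infinity, where Y_beta ~ N(theta, (1+beta) sigma^2 I_n). Define the irreducible variance IVar(CB_alpha(g)) = Var( E[ ||Y - omega/sqrt(alpha) - g(Y + sqrt(alpha) omega)||_2^2 - ||omega||_2^2/alpha | Y ] ). Then lim_{alpha -> 0} IVar(CB_alpha(g)) = Var( ||Y - g(Y)||_2^2 + h(Y) ). -/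

import Mathlib

open MeasureTheory ProbabilityTheory Filter

/-- The distribution `N(m, v I_n)` on `ℝⁿ`, i.e. the product of one-dimensional Gaussians
with means `m i` and common variance `v`. -/
noncomputable def gaussianPi (n : ℕ) (m : Fin n → ℝ) (v : ℝ) : Measure (Fin n → ℝ) :=
  Measure.pi fun i => gaussianReal (m i) v.toNNReal

/-- The variance of a real-valued function under a measure `ν`. -/
noncomputable def varUnder {X : Type*} [MeasurableSpace X] (ν : Measure X) (f : X → ℝ) : ℝ :=
  ∫ x, (f x - ∫ y, f y ∂ν) ^ 2 ∂ν

open scoped ENNReal NNReal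

instance gaussianPi_isProb (n : ℕ) (m : Fin n → ℝ) (v : ℝ) :
    IsProbabilityMeasure (gaussianPi n m v) := by
  unfold gaussianPi; infer_instance

lemma pi_le_smul_pi {n : ℕ} (μ ν : Fin n → Measure ℝ) [∀ i, SigmaFinite (μ i)]
    [∀ i, SigmaFinite (ν i)] (C : ℝ≥0) (hle : ∀ i, μ i ≤ (C : ℝ≥0∞) • ν i) :
    Measure.pi μ ≤ ((C : ℝ≥0∞) ^ n) • Measure.pi ν := by
  have h1 : Measure.pi (fun i => C • ν i) = ((C : ℝ≥0∞) ^ n) • Measure.pi ν := by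
    refine Measure.pi_eq ?_
    intro s hs
    simp [Measure.pi_pi, Finset.prod_mul_distrib]
  rw [← h1]
  refine Measure.le_iff.2 fun s hs => ?_
  have h2 : (Measure.pi μ).toOuterMeasure ≤
      OuterMeasure.pi (fun i => (C • ν i).toOuterMeasure) := by
    rw [OuterMeasure.le_pi]
    intro t ht
    change Measure.pi μ _ ≤ _
    rw [Measure.pi_pi]
    exact Finset.prod_le_prod' fun i _ => hle i (t i)
  refine (h2 s).trans ?_
  rw [Measure.pi]
  exact le_toMeasure_apply _ _ _

lemma gaussianReal_le_vol (m : ℝ) (v : ℝ≥0) (hv : v ≠ 0) :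
    gaussianReal m v ≤ ((Real.toNNReal (√(2 * Real.pi * v))⁻¹ : ℝ≥0) : ℝ≥0∞) • volume := by
  rw [gaussianReal_of_var_ne_zero _ hv, ← withDensity_const]
  refine withDensity_mono (ae_of_all _ fun x => ?_)
  rw [gaussianPDF]
  refine ENNReal.ofReal_le_ofReal ?_
  rw [gaussianPDFReal]
  refine mul_le_of_le_one_right (by positivity) (Real.exp_le_one_iff.2 ?_)
  exact div_nonpos_of_nonpos_of_nonneg (by nlinarith [sq_nonneg (x - m)]) (by positivity)

lemma gaussianReal_le (m : ℝ) (v w : ℝ≥0) (hv : v ≠ 0) (hvw : v ≤ w) :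
    gaussianReal m v ≤ ((Real.toNNReal √(w / v) : ℝ≥0) : ℝ≥0∞) • gaussianReal m w := by
  have hw : w ≠ 0 := (lt_of_lt_of_le (pos_iff_ne_zero.2 hv) hvw).ne'
  rw [gaussianReal_of_var_ne_zero _ hv, gaussianReal_of_var_ne_zero _ hw,
    ← withDensity_smul _ (measurable_gaussianPDF _ _)]
  refine withDensity_mono (ae_of_all _ fun x => ?_)
  rw [Pi.smul_apply, smul_eq_mul, gaussianPDF, gaussianPDF]
  change _ ≤ ENNReal.ofReal _ * _
  rw [← ENNReal.ofReal_mul (by positivity)]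
  refine ENNReal.ofReal_le_ofReal ?_
  rw [gaussianPDFReal, gaussianPDFReal, ← mul_assoc]
  have hv' : (0:ℝ) < v := by exact_mod_cast pos_iff_ne_zero.2 hv
  have hw' : (0:ℝ) < w := by exact_mod_cast pos_iff_ne_zero.2 hw
  have hvw' : (v:ℝ) ≤ w := by exact_mod_cast hvw
  have e : √((w:ℝ) / v) * (√(2 * Real.pi * w))⁻¹ = (√(2 * Real.pi * v))⁻¹ := by
    rw [← Real.sqrt_inv, ← Real.sqrt_inv, ← Real.sqrt_mul (by positivity)]
    congr 1
    field_simp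
  rw [e]
  refine mul_le_mul_of_nonneg_left (Real.exp_le_exp.2 ?_) (by positivity)
  rw [neg_div, neg_div, neg_le_neg_iff]
  gcongr

lemma gaussianPi_ac {n : ℕ} (θ : Fin n → ℝ) {σ2 : ℝ} (hσ2 : 0 < σ2) :
    gaussianPi n θ σ2 ≪ volume := by
  have hv : σ2.toNNReal ≠ 0 := by simpa using hσ2
  have := pi_le_smul_pi (fun i => gaussianReal (θ i) σ2.toNNReal) (fun _ => volume) _
    (fun i => gaussianReal_le_vol (θ i) _ hv)
  exact Measure.AbsolutelyContinuous.trans (Measure.absolutelyContinuous_of_le this)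
    (Measure.smul_absolutelyContinuous)

lemma gaussianPi_le {n : ℕ} (θ : Fin n → ℝ) {σ2 : ℝ} (hσ2 : 0 < σ2) {β : ℝ} :
    ∃ C : ℝ≥0, ∀ α, 0 ≤ α → α ≤ β →
      gaussianPi n θ ((1 + α) * σ2) ≤ (C : ℝ≥0∞) • gaussianPi n θ ((1 + β) * σ2) := by
  refine ⟨(Real.toNNReal √(((1 + β) * σ2).toNNReal / σ2.toNNReal)) ^ n, fun α h0 h1 => ?_⟩
  have h2 : 0 < (1 + α) * σ2 := by positivity
  have hv : ((1 + α) * σ2).toNNReal ≠ 0 := by simpa using h2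
  have hle : ((1 + α) * σ2).toNNReal ≤ ((1 + β) * σ2).toNNReal := by
    apply Real.toNNReal_le_toNNReal; gcongr
  rw [ENNReal.coe_pow]
  refine pi_le_smul_pi _ _ _ fun i => (gaussianReal_le (θ i) _ _ hv hle).trans ?_
  have hs : (σ2.toNNReal : ℝ) ≤ ((1 + α) * σ2).toNNReal := by
    rw [NNReal.coe_le_coe]; apply Real.toNNReal_le_toNNReal; nlinarith
  have hs0 : (0:ℝ) < (σ2.toNNReal : ℝ) := by simpa using hσ2
  refine Measure.le_iff.2 fun s _ => ?_
  simp only [Measure.smul_apply, smul_eq_mul]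
  gcongr

lemma map_shift {n : ℕ} (θ : Fin n → ℝ) {σ2 : ℝ} (hσ2 : 0 < σ2) {α : ℝ} (hα : 0 ≤ α) :
    MeasurePreserving (fun p : (Fin n → ℝ) × (Fin n → ℝ) => fun j => p.1 j + √α * p.2 j)
      ((gaussianPi n θ σ2).prod (gaussianPi n 0 σ2)) (gaussianPi n θ ((1 + α) * σ2)) := by
  have h1 := (measurePreserving_arrowProdEquivProdArrow ℝ ℝ (Fin n)
    (fun i => gaussianReal (θ i) σ2.toNNReal) (fun i => gaussianReal 0 σ2.toNNReal)).symm
  have h3 : ∀ i, MeasurePreserving (fun p : ℝ × ℝ => p.1 + √α * p.2)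
      ((gaussianReal (θ i) σ2.toNNReal).prod (gaussianReal 0 σ2.toNNReal))
      (gaussianReal (θ i) ((1 + α) * σ2).toNNReal) := by
    intro i
    refine ⟨by fun_prop, ?_⟩
    have e : (fun p : ℝ × ℝ => p.1 + √α * p.2) =
      (fun p : ℝ × ℝ => p.1 + p.2) ∘ (Prod.map id (fun x => √α * x)) := rfl
    rw [e, ← Measure.map_map (by fun_prop) (by fun_prop),
      ← Measure.map_prod_map _ _ (by fun_prop) (by fun_prop), Measure.map_id,
      gaussianReal_map_const_mul]
    change Measure.conv _ _ = _
    rw [gaussianReal_conv_gaussianReal]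
    congr 1
    · simp
    · ext
      simp [Real.sq_sqrt hα, hσ2.le, (by positivity : 0 ≤ (1 + α) * σ2)]
      ring
  have h2 := measurePreserving_pi _ _ h3
  exact h2.comp h1

/-- Gaussian smoothing. -/
noncomputable def gsmooth {n : ℕ} (σ2 α : ℝ) (u : (Fin n → ℝ) → ℝ) (y : Fin n → ℝ) : ℝ :=
  ∫ w, u (fun j => y j + √α * w j) ∂(gaussianPi n 0 σ2)

lemma measurable_shift {n : ℕ} (α : ℝ) :
    Measurable (fun p : (Fin n → ℝ) × (Fin n → ℝ) => fun j => p.1 j + √α * p.2 j) := by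
  fun_prop

lemma gsmooth_sm {n : ℕ} (σ2 α : ℝ) {u : (Fin n → ℝ) → ℝ} (hu : Measurable u) :
    StronglyMeasurable (gsmooth σ2 α u) := by
  have : StronglyMeasurable (fun p : (Fin n → ℝ) × (Fin n → ℝ) =>
      u (fun j => p.1 j + √α * p.2 j)) := (hu.comp (measurable_shift α)).stronglyMeasurable
  exact this.integral_prod_right (ν := gaussianPi n 0 σ2)

lemma eLpNorm_two_sq {X : Type*} [MeasurableSpace X] (μ : Measure X) (f : X → ℝ) :
    (eLpNorm f 2 μ) ^ 2 = ∫⁻ x, ‖f x‖ₑ ^ 2 ∂μ := by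
  have := eLpNorm_nnreal_pow_eq_lintegral (f := f) (μ := μ) (p := 2) (by norm_num)
  simpa using this

lemma gsmooth_bound {n : ℕ} (θ : Fin n → ℝ) {σ2 : ℝ} (hσ2 : 0 < σ2) {α : ℝ} (hα : 0 ≤ α)
    {u : (Fin n → ℝ) → ℝ} (hu : Measurable u) :
    eLpNorm (gsmooth σ2 α u) 2 (gaussianPi n θ σ2) ≤
      eLpNorm u 2 (gaussianPi n θ ((1 + α) * σ2)) := by
  rw [← ENNReal.pow_le_pow_left_iff (two_ne_zero), eLpNorm_two_sq, eLpNorm_two_sq,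
    ← (map_shift θ hσ2 hα).lintegral_comp (by fun_prop),
    lintegral_prod _ (by
      exact Measurable.aemeasurable ((hu.comp (measurable_shift α)).enorm.pow_const 2))]
  refine lintegral_mono fun y => ?_
  have hm : Measurable (fun w : Fin n → ℝ => u (fun j => y j + √α * w j)) :=
    hu.comp (by fun_prop)
  rw [← eLpNorm_two_sq (gaussianPi n 0 σ2) (fun w => u (fun j => y j + √α * w j))]
  gcongr
  calc _ ≤ ∫⁻ w, ‖u (fun j => y j + √α * w j)‖ₑ ∂(gaussianPi n 0 σ2) :=
        enorm_integral_le_lintegral_enorm _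
    _ = eLpNorm (fun w => u (fun j => y j + √α * w j)) 1 (gaussianPi n 0 σ2) :=
        eLpNorm_one_eq_lintegral_enorm.symm
    _ ≤ _ := eLpNorm_le_eLpNorm_of_exponent_le (by norm_num) hm.aestronglyMeasurable

lemma eLpNorm_tendsto_of_dom {X : Type*} [MeasurableSpace X] (μ : Measure X)
    (l : Filter ℝ) [l.IsCountablyGenerated] (D : ℝ → X → ℝ) (G : X → ℝ)
    (hm : ∀ᶠ α in l, AEStronglyMeasurable (D α) μ)
    (hb : ∀ᶠ α in l, ∀ᵐ x ∂μ, (D α x) ^ 2 ≤ G x) (hG : Integrable G μ)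
    (hl : ∀ᵐ x ∂μ, Tendsto (fun α => D α x) l (nhds 0)) :
    Tendsto (fun α => eLpNorm (D α) 2 μ) l (nhds 0) := by
  have key : Tendsto (fun α => ∫⁻ x, ‖D α x‖ₑ ^ 2 ∂μ) l (nhds (∫⁻ x, 0 ∂μ)) := by
    refine tendsto_lintegral_filter_of_dominated_convergence' (fun x => ‖G x‖ₑ) ?_ ?_ ?_ ?_
    · filter_upwards [hm] with α h
      exact h.enorm.pow_const 2
    · filter_upwards [hb] with α h
      filter_upwards [h] with x hx
      rw [← enorm_pow, Real.enorm_eq_ofReal (sq_nonneg _)]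
      rw [Real.enorm_eq_ofReal ((sq_nonneg _).trans hx)]
      exact ENNReal.ofReal_le_ofReal hx
    · exact hG.2.ne
    · filter_upwards [hl] with x hx
      have := (continuous_enorm.tendsto (0:ℝ)).comp hx
      simpa using ENNReal.Tendsto.pow (n := 2) this
  simp only [← eLpNorm_two_sq, lintegral_zero] at key
  have := (ENNReal.continuous_rpow_const (y := (1/2 : ℝ))).tendsto 0 |>.comp key
  rw [ENNReal.zero_rpow_of_pos (by norm_num)] at this
  refine this.congr fun α => ?_
  simp only [Function.comp]
  rw [← ENNReal.rpow_natCast, ← ENNReal.rpow_mul]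
  norm_num

lemma gsmooth_int {n : ℕ} (θ : Fin n → ℝ) {σ2 : ℝ} (hσ2 : 0 < σ2) {α : ℝ} (hα : 0 ≤ α)
    {u : (Fin n → ℝ) → ℝ} (hu : Integrable u (gaussianPi n θ ((1 + α) * σ2))) :
    ∀ᵐ y ∂(gaussianPi n θ σ2),
      Integrable (fun w => u (fun j => y j + √α * w j)) (gaussianPi n 0 σ2) := by
  have := ((map_shift θ hσ2 hα).integrable_comp hu.aestronglyMeasurable).2 hu
  exact this.prod_right_ae

lemma gsmooth_tendsto_bc {n : ℕ} (θ : Fin n → ℝ) {σ2 : ℝ}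
    (φ : BoundedContinuousFunction (Fin n → ℝ) ℝ) :
    Tendsto (fun α => eLpNorm (gsmooth σ2 α φ - ⇑φ) 2 (gaussianPi n θ σ2))
      (nhdsWithin 0 (Set.Ioi 0)) (nhds 0) := by
  have hb : ∀ α y, |gsmooth σ2 α φ y| ≤ ‖φ‖ := fun α y => by
    have := norm_integral_le_of_norm_le_const (μ := gaussianPi n 0 σ2)
      (f := fun w => φ (fun j => y j + √α * w j)) (ae_of_all _ fun w => φ.norm_coe_le_norm _)
    simpa [gsmooth] using this
  refine eLpNorm_tendsto_of_dom _ _ _ (fun _ => (2 * ‖φ‖) ^ 2) ?_ ?_ (integrable_const _) ?_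
  · refine .of_forall fun α => ?_
    exact ((gsmooth_sm _ _ φ.continuous.measurable).sub
      φ.continuous.stronglyMeasurable).aestronglyMeasurable
  · refine .of_forall fun α => ae_of_all _ fun y => ?_
    refine sq_le_sq' ?_ ?_ <;> 
    · have h1 := abs_le.1 (hb α y)
      have h2 := abs_le.1 (φ.norm_coe_le_norm y)
      simp only [Pi.sub_apply]
      linarith [h1.1, h1.2, h2.1, h2.2]
  · refine ae_of_all _ fun y => ?_
    have : Tendsto (fun α => gsmooth σ2 α φ y) (nhdsWithin 0 (Set.Ioi 0))
        (nhds (∫ w, φ y ∂(gaussianPi n 0 σ2))) := by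
      refine tendsto_integral_filter_of_dominated_convergence (fun _ => ‖φ‖) ?_ ?_
        (integrable_const _) ?_
      · refine .of_forall fun α => ?_
        exact (φ.continuous.comp (by fun_prop)).aestronglyMeasurable
      · exact .of_forall fun α => ae_of_all _ fun y => φ.norm_coe_le_norm _
      · refine ae_of_all _ fun w => ?_
        have hc : Continuous (fun α : ℝ => φ (fun j => y j + √α * w j)) :=
          φ.continuous.comp (by fun_prop)
        have := hc.tendsto 0
        simp only [Real.sqrt_zero, zero_mul, add_zero] at this
        exact this.mono_left nhdsWithin_le_nhds
    simp only [integral_const, probReal_univ, one_smul] at this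
    simpa using this.sub_const (φ y)

lemma gsmooth_tendsto {n : ℕ} (θ : Fin n → ℝ) {σ2 : ℝ} (hσ2 : 0 < σ2) {β : ℝ} (hβ : 0 < β)
    {u : (Fin n → ℝ) → ℝ} (hu : Measurable u)
    (hu2 : MemLp u 2 (gaussianPi n θ ((1 + β) * σ2))) :
    Tendsto (fun α => eLpNorm (gsmooth σ2 α u - u) 2 (gaussianPi n θ σ2))
      (nhdsWithin 0 (Set.Ioi 0)) (nhds 0) := by
  obtain ⟨C, hC⟩ := gaussianPi_le θ hσ2 (β := β)
  set K : ℝ≥0∞ := (C : ℝ≥0∞) ^ (1 / 2 : ℝ)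
  have hK : K ≠ ∞ := by simp [K]
  have hbd : ∀ (v : (Fin n → ℝ) → ℝ) α, 0 ≤ α → α ≤ β →
      eLpNorm v 2 (gaussianPi n θ ((1 + α) * σ2)) ≤
        K * eLpNorm v 2 (gaussianPi n θ ((1 + β) * σ2)) := by
    intro v α h0 h1
    refine (eLpNorm_mono_measure v (hC α h0 h1)).trans ?_
    rw [eLpNorm_smul_measure_of_ne_top (by norm_num)]
    simp [K]
  rw [ENNReal.tendsto_nhds_zero]
  intro ε hε
  obtain ⟨δ, hδ0, hδ⟩ : ∃ δ : ℝ≥0∞, δ ≠ 0 ∧ K * δ + K * δ ≤ ε / 2 := by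
    have : Tendsto (fun δ : ℝ≥0∞ => K * δ + K * δ) (nhdsWithin 0 (Set.Ioi 0)) (nhds 0) := by
      have h := ENNReal.Tendsto.const_mul (a := K) (tendsto_id (α := ℝ≥0∞) (x := nhds 0))
        (Or.inr hK)
      have h' := h.add h
      simp only [mul_zero, add_zero, id] at h'
      exact h'.mono_left nhdsWithin_le_nhds
    have h2 := (ENNReal.tendsto_nhds_zero.1 this) (ε / 2) (ENNReal.half_pos hε.ne')
    obtain ⟨δ, h3, h4⟩ := (h2.and self_mem_nhdsWithin).exists
    exact ⟨δ, ne_of_gt h4, h3⟩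
  obtain ⟨φ, hφ, hφm⟩ := hu2.exists_boundedContinuous_eLpNorm_sub_le (by norm_num) hδ0
  have hφc := gsmooth_tendsto_bc θ (σ2 := σ2) φ
  have hφc := (ENNReal.tendsto_nhds_zero.1 hφc) (ε / 2) (ENNReal.half_pos hε.ne')
  have hmem : Set.Ioc 0 β ∈ nhdsWithin (0:ℝ) (Set.Ioi 0) := Ioc_mem_nhdsGT hβ
  filter_upwards [hφc, hmem] with α h1 h2
  have hum : Measurable (u - ⇑φ) := hu.sub φ.continuous.measurable
  have b1 := (gsmooth_bound θ hσ2 h2.1.le hum).trans (hbd _ α h2.1.le h2.2)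
  have b2 := hbd (u - ⇑φ) 0 le_rfl hβ.le
  simp only [add_zero, one_mul] at b2
  have hui : MemLp u 2 (gaussianPi n θ ((1 + α) * σ2)) :=
    ⟨hu.aestronglyMeasurable, (hbd u α h2.1.le h2.2).trans_lt (ENNReal.mul_lt_top hK.lt_top hu2.2)⟩
  have hae : gsmooth σ2 α u - u =ᵐ[gaussianPi n θ σ2]
      gsmooth σ2 α (u - ⇑φ) + (gsmooth σ2 α φ - ⇑φ) - (u - ⇑φ) := by
    filter_upwards [gsmooth_int θ hσ2 h2.1.le (hui.integrable (by norm_num))] with y hy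
    have hφi : Integrable (fun w => φ (fun j => y j + √α * w j)) (gaussianPi n 0 σ2) :=
      Integrable.of_bound (φ.continuous.comp (by fun_prop)).aestronglyMeasurable ‖φ‖
        (ae_of_all _ fun w => φ.norm_coe_le_norm _)
    have e : gsmooth σ2 α (u - ⇑φ) y = gsmooth σ2 α u y - gsmooth σ2 α φ y :=
      integral_sub hy hφi
    simp only [Pi.sub_apply, Pi.add_apply, e]
    ring
  rw [eLpNorm_congr_ae hae]
  have m1 := (gsmooth_sm σ2 α hum).aestronglyMeasurable (μ := gaussianPi n θ σ2)
  have m2 := ((gsmooth_sm σ2 α φ.continuous.measurable).sub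
      φ.continuous.stronglyMeasurable).aestronglyMeasurable (μ := gaussianPi n θ σ2)
  have m3 := hum.aestronglyMeasurable (μ := gaussianPi n θ σ2)
  calc _ ≤ eLpNorm (gsmooth σ2 α (u - ⇑φ) + (gsmooth σ2 α φ - ⇑φ)) 2 (gaussianPi n θ σ2)
          + eLpNorm (u - ⇑φ) 2 (gaussianPi n θ σ2) :=
        eLpNorm_sub_le (m1.add m2) m3 (by norm_num)
    _ ≤ (eLpNorm (gsmooth σ2 α (u - ⇑φ)) 2 (gaussianPi n θ σ2)
        + eLpNorm (gsmooth σ2 α φ - ⇑φ) 2 (gaussianPi n θ σ2))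
          + eLpNorm (u - ⇑φ) 2 (gaussianPi n θ σ2) := by
        gcongr; exact eLpNorm_add_le m1 m2 (by norm_num)
    _ ≤ (K * δ + ε / 2) + K * δ := by
        gcongr
        · exact b1.trans (by gcongr)
        · exact b2.trans (by gcongr)
    _ = (K * δ + K * δ) + ε / 2 := by ring
    _ ≤ ε / 2 + ε / 2 := by gcongr
    _ = ε := ENNReal.add_halves ε

lemma varUnder_eq {X : Type*} [MeasurableSpace X] (μ : Measure X) [IsProbabilityMeasure μ]
    {f : X → ℝ} (hf : MemLp f 2 μ) :
    varUnder μ f = (∫ x, f x ^ 2 ∂μ) - (∫ x, f x ∂μ) ^ 2 := by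
  have h1 := variance_eq_sub hf
  rw [variance_eq_integral hf.1.aemeasurable] at h1
  simpa [varUnder] using h1

lemma var_tendsto {X : Type*} [MeasurableSpace X] (μ : Measure X) [IsProbabilityMeasure μ]
    (l : Filter ℝ) (F : ℝ → X → ℝ) (f : X → ℝ) (hf : MemLp f 2 μ)
    (hF : ∀ᶠ α in l, AEStronglyMeasurable (F α) μ)
    (h : Tendsto (fun α => eLpNorm (F α - f) 2 μ) l (nhds 0)) :
    Tendsto (fun α => varUnder μ (F α)) l (nhds (varUnder μ f)) := by
  have hle1 : ∀ᶠ α in l, eLpNorm (F α - f) 2 μ ≤ 1 :=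
    (ENNReal.tendsto_nhds_zero.1 h) 1 one_pos
  have hM : ∀ᶠ α in l, MemLp (F α) 2 μ := by
    filter_upwards [hF, hle1] with α h1 h2
    have : MemLp (F α - f) 2 μ := ⟨h1.sub hf.1, h2.trans_lt (by simp)⟩
    simpa using this.add hf
  have hI : Tendsto (fun α => ∫ x, F α x ∂μ) l (nhds (∫ x, f x ∂μ)) := by
    refine tendsto_integral_of_L1' f (hf.integrable (by norm_num)).aestronglyMeasurable ?_ ?_
    · filter_upwards [hM] with α h1
      exact h1.integrable (by norm_num)
    · refine tendsto_of_tendsto_of_tendsto_of_le_of_le' tendsto_const_nhds h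
        (.of_forall fun _ => zero_le) ?_
      filter_upwards [hF] with α h1
      exact eLpNorm_le_eLpNorm_of_exponent_le (by norm_num) (h1.sub hf.1)
  have hI2 : Tendsto (fun α => ∫ x, F α x ^ 2 ∂μ) l (nhds (∫ x, f x ^ 2 ∂μ)) := by
    refine tendsto_integral_of_L1' (fun x => f x ^ 2) hf.integrable_sq.aestronglyMeasurable ?_ ?_
    · filter_upwards [hM] with α h1
      exact h1.integrable_sq
    · set B : ℝ≥0∞ := 1 + (eLpNorm f 2 μ + eLpNorm f 2 μ)
      have hB : B ≠ ∞ := by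
        have := hf.2.ne
        simp [B, this]
      have h0 : Tendsto (fun α => eLpNorm (F α - f) 2 μ * B) l (nhds 0) := by
        simpa using ENNReal.Tendsto.mul_const h (Or.inr hB)
      refine tendsto_of_tendsto_of_tendsto_of_le_of_le' tendsto_const_nhds h0
        (.of_forall fun _ => zero_le) ?_
      filter_upwards [hF, hle1] with α h1 h2
      have e : ((fun α x => F α x ^ 2) α - fun x => f x ^ 2) = (F α - f) • ((F α - f) + (f + f)) := by
        ext x
        simp only [Pi.sub_apply, Pi.smul_apply', Pi.add_apply, smul_eq_mul]
        ring
      have h3 := eLpNorm_smul_le_mul_eLpNorm (p := 2) (q := 2) (r := 1)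
        ((h1.sub hf.1).add (hf.1.add hf.1)) (h1.sub hf.1)
      rw [← e] at h3
      refine h3.trans (mul_le_mul' le_rfl ?_)
      refine (eLpNorm_add_le (h1.sub hf.1) (hf.1.add hf.1) (by norm_num)).trans ?_
      exact add_le_add h2 (eLpNorm_add_le hf.1 hf.1 (by norm_num))
  rw [varUnder_eq μ hf]
  refine (hI2.sub (hI.pow 2)).congr' ?_
  filter_upwards [hM] with α h1
  rw [varUnder_eq μ h1]

lemma coord_mp {n : ℕ} (m : Fin n → ℝ) (v : ℝ) (i : Fin n) :
    MeasurePreserving (fun w : Fin n → ℝ => w i) (gaussianPi n m v)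
      (gaussianReal (m i) v.toNNReal) :=
  measurePreserving_eval (fun i => gaussianReal (m i) v.toNNReal) i

lemma coord_memLp {n : ℕ} (m : Fin n → ℝ) (v : ℝ) (i : Fin n) (p : ℝ≥0) :
    MemLp (fun w : Fin n → ℝ => w i) p (gaussianPi n m v) :=
  (memLp_id_gaussianReal p).comp_measurePreserving (coord_mp m v i)

lemma coord_int {n : ℕ} (v : ℝ) (i : Fin n) :
    ∫ w, w i ∂(gaussianPi n 0 v) = 0 := by
  have h := integral_id_gaussianReal (μ := (0:ℝ)) (v := v.toNNReal)
  have h2 := coord_mp (0 : Fin n → ℝ) v i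
  rw [Pi.zero_apply] at h2
  rw [← h2.map_eq, integral_map h2.measurable.aemeasurable (by fun_prop)] at h
  exact h

lemma u_memLp {n : ℕ} (θ : Fin n → ℝ) (v : ℝ) (g : (Fin n → ℝ) → (Fin n → ℝ)) (hg : Measurable g)
    (hg4 : MemLp (fun y => ∑ i, (g y i) ^ 2) 2 (gaussianPi n θ v)) :
    MemLp (fun y => ∑ i, (y i - g y i) ^ 2) 2 (gaussianPi n θ v) := by
  have h1 : MemLp (fun y : Fin n → ℝ => ∑ i, (y i) ^ 2) 2 (gaussianPi n θ v) := by
    refine memLp_finsetSum _ fun i _ => ?_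
    rw [memLp_two_iff_integrable_sq (Measurable.aestronglyMeasurable (by fun_prop))]
    have := (coord_memLp θ v i 4).integrable_norm_pow (p := 4) (by norm_num)
    refine this.congr (ae_of_all _ fun y => ?_)
    simp only [Real.norm_eq_abs]
    rw [← pow_mul]
    exact Even.pow_abs (by decide) _
  refine ((h1.const_mul 2).add (hg4.const_mul 2)).mono' (by fun_prop) (ae_of_all _ fun y => ?_)
  rw [Real.norm_eq_abs, abs_of_nonneg (Finset.sum_nonneg fun i _ => sq_nonneg _)]
  simp only [Pi.add_apply, Finset.mul_sum, ← Finset.sum_add_distrib]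
  refine Finset.sum_le_sum fun i _ => ?_
  nlinarith [sq_nonneg (y i + g y i)]

lemma int_lin {X : Type*} [MeasurableSpace X] (μ : Measure X) (k a : ℝ) {f1 f2 f3 f4 : X → ℝ}
    (h1 : Integrable f1 μ) (h2 : Integrable f2 μ) (h3 : Integrable f3 μ) (h4 : Integrable f4 μ) :
    ∫ x, (f1 x + k * f2 x - k * f3 x - a * f4 x) ∂μ =
      ∫ x, f1 x ∂μ + k * ∫ x, f2 x ∂μ - k * ∫ x, f3 x ∂μ - a * ∫ x, f4 x ∂μ := by
  have i2 := h2.const_mul k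
  have i3 := h3.const_mul k
  have i4 := h4.const_mul a
  have i12 : Integrable (fun x => f1 x + k * f2 x) μ := h1.add i2
  have i123 : Integrable (fun x => f1 x + k * f2 x - k * f3 x) μ := i12.sub i3
  rw [integral_sub i123 i4, integral_sub i12 i3, integral_add h1 i2]
  simp only [integral_const_mul]

lemma F_formula {n : ℕ} (σ2 : ℝ) (g : (Fin n → ℝ) → (Fin n → ℝ)) (hg : Measurable g)
    {α : ℝ} (hα : 0 < α) (y : Fin n → ℝ)
    (h1 : Integrable (fun w : Fin n → ℝ => (fun z : Fin n → ℝ => ∑ i, (z i - g z i) ^ 2)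
      (fun j => y j + √α * w j)) (gaussianPi n 0 σ2))
    (h2 : Integrable (fun w : Fin n → ℝ => (fun z : Fin n → ℝ => ∑ i, (g z i) ^ 2)
      (fun j => y j + √α * w j)) (gaussianPi n 0 σ2)) :
    (∫ w, ((∑ i, (y i - w i / √α - g (fun j => y j + √α * w j) i) ^ 2)
            - (∑ i, (w i) ^ 2) / α) ∂(gaussianPi n 0 σ2)) =
      gsmooth σ2 α (fun z => ∑ i, (z i - g z i) ^ 2) y
      + (1 + α) * ((2 / √α) * ∫ w, ∑ i, w i * g (fun j => y j + √α * w j) i ∂(gaussianPi n 0 σ2))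
      - α * ∫ w, ∑ i, (w i) ^ 2 ∂(gaussianPi n 0 σ2) := by
  have hs : 0 < √α := Real.sqrt_pos.2 hα
  have hss : √α * √α = α := Real.mul_self_sqrt hα.le
  have hi2 : ∀ i : Fin n, Integrable (fun w : Fin n → ℝ => (w i) ^ 2) (gaussianPi n 0 σ2) :=
    fun i => (coord_memLp 0 σ2 i 2).integrable_sq
  have h3 : Integrable (fun w : Fin n → ℝ => ∑ i, (w i) ^ 2) (gaussianPi n 0 σ2) :=
    integrable_finsetSum _ fun i _ => hi2 i
  have hi1 : ∀ i : Fin n, Integrable (fun w : Fin n → ℝ => w i * y i) (gaussianPi n 0 σ2) :=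
    fun i => ((coord_memLp 0 σ2 i 1).integrable (by norm_num)).mul_const _
  have h4 : Integrable (fun w : Fin n → ℝ => ∑ i, w i * y i) (gaussianPi n 0 σ2) :=
    integrable_finsetSum _ fun i _ => hi1 i
  have e4 : ∫ w : Fin n → ℝ, ∑ i, w i * y i ∂(gaussianPi n 0 σ2) = 0 := by
    rw [integral_finsetSum _ fun i _ => hi1 i]
    refine Finset.sum_eq_zero fun i _ => ?_
    rw [integral_mul_const, coord_int, zero_mul]
  have h5 : Integrable (fun w : Fin n → ℝ => ∑ i, w i * g (fun j => y j + √α * w j) i)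
      (gaussianPi n 0 σ2) := by
    refine integrable_finsetSum _ fun i _ => ?_
    refine ((hi2 i).add h2).mono' ?_ (ae_of_all _ fun w => ?_)
    · have : Measurable (fun w : Fin n → ℝ => g (fun j => y j + √α * w j)) :=
        hg.comp (by fun_prop)
      exact Measurable.aestronglyMeasurable (by fun_prop)
    · have : (g (fun j => y j + √α * w j) i) ^ 2 ≤ ∑ i, (g (fun j => y j + √α * w j) i) ^ 2 :=
        Finset.single_le_sum (f := fun i => (g (fun j => y j + √α * w j) i) ^ 2)
          (fun i _ => sq_nonneg _) (Finset.mem_univ i)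
      simp only [Pi.add_apply, Real.norm_eq_abs]
      generalize g (fun j => y j + √α * w j) i = t at *
      rw [abs_le]
      constructor <;> nlinarith [sq_nonneg (w i + t), sq_nonneg (w i - t), sq_nonneg (w i), sq_nonneg t]
  have hpt : ∀ w : Fin n → ℝ, ((∑ i, (y i - w i / √α - g (fun j => y j + √α * w j) i) ^ 2)
            - (∑ i, (w i) ^ 2) / α) =
      (fun z : Fin n → ℝ => ∑ i, (z i - g z i) ^ 2) (fun j => y j + √α * w j)
      + ((1 + α) * (2 / √α)) * (∑ i, w i * g (fun j => y j + √α * w j) i)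
      - ((1 + α) * (2 / √α)) * (∑ i, w i * y i) - α * ∑ i, (w i) ^ 2 := by
    intro w
    simp only [Finset.mul_sum, Finset.sum_div, ← Finset.sum_add_distrib, ← Finset.sum_sub_distrib]
    refine Finset.sum_congr rfl fun i _ => ?_
    generalize g (fun j => y j + √α * w j) i = t
    generalize √α = s at hs hss ⊢
    subst hss
    field_simp
    ring
  rw [integral_congr_ae (ae_of_all _ hpt), int_lin _ _ _ h1 h5 h4 h3, e4]
  simp only [gsmooth]
  ring

/-- **Small-`α` limit of the irreducible variance (Proposition 5).**
Let `Y ~ N(θ, σ² Iₙ)` and `ω ~ N(0, σ² Iₙ)`.  Assume (i) the rescaled cross term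
`(2/√α) E[⟨ω, g(y + √α ω)⟩]` converges to `h(y)` for a.e. `y` as `α → 0⁺`; (ii) there is a
dominating function `H` with `E[H(Y)] < ∞` such that
`(4/α) (E[⟨ω, g(y + √α ω)⟩])² ≤ H(y)` for a.e. `y` and all `α ∈ (0, β]`; and (iii)
`E‖g(Y_β)‖⁴ < ∞`.  Then the irreducible variance
`IVar(CB_α(g)) = Var(E[‖Y - ω/√α - g(Y + √α ω)‖² - ‖ω‖²/α | Y])` converges, as `α → 0⁺`,
to `Var(‖Y - g(Y)‖² + h(Y))`.  (The conditional expectation given `Y = y` is written as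
the integral over the law `γ = N(0, σ² Iₙ)` of `ω`.) -/
theorem cb_irreducible_variance_limit
    {n : ℕ} (θ : Fin n → ℝ) (σ2 : ℝ) (hσ2 : 0 < σ2)
    (g : (Fin n → ℝ) → (Fin n → ℝ)) (hg : Measurable g)
    (h : (Fin n → ℝ) → ℝ) (hh : Measurable h)
    (hlim : ∀ᵐ y ∂(volume : Measure (Fin n → ℝ)),
      Tendsto (fun α : ℝ => (2 / Real.sqrt α)
          * ∫ w, ∑ i, w i * g (fun j => y j + Real.sqrt α * w j) i
              ∂(gaussianPi n 0 σ2))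
        (nhdsWithin 0 (Set.Ioi 0)) (nhds (h y)))
    (β : ℝ) (hβ : 0 < β)
    (H : (Fin n → ℝ) → ℝ) (hH : Measurable H)
    (hHint : Integrable H (gaussianPi n θ σ2))
    (hdom : ∀ᵐ y ∂(volume : Measure (Fin n → ℝ)), ∀ α ∈ Set.Ioc (0 : ℝ) β,
      (4 / α) * (∫ w, ∑ i, w i * g (fun j => y j + Real.sqrt α * w j) i
          ∂(gaussianPi n 0 σ2)) ^ 2 ≤ H y)
    (hg4 : Integrable (fun y => (∑ i, (g y i) ^ 2) ^ 2)
      (gaussianPi n θ ((1 + β) * σ2))) :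
    Tendsto (fun α : ℝ =>
        varUnder (gaussianPi n θ σ2) (fun y =>
          ∫ w, ((∑ i, (y i - w i / Real.sqrt α
              - g (fun j => y j + Real.sqrt α * w j) i) ^ 2)
            - (∑ i, (w i) ^ 2) / α) ∂(gaussianPi n 0 σ2)))
      (nhdsWithin 0 (Set.Ioi 0))
      (nhds (varUnder (gaussianPi n θ σ2)
        (fun y => (∑ i, (y i - g y i) ^ 2) + h y))) := by
  obtain ⟨K, hK⟩ := gaussianPi_le (n := n) θ hσ2 (β := β)
  have hac := gaussianPi_ac (n := n) θ hσ2
  set μ := gaussianPi n θ σ2 with hμ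
  set Cr : ℝ → (Fin n → ℝ) → ℝ := fun α y => (2 / √α) *
    ∫ w, ∑ i, w i * g (fun j => y j + √α * w j) i ∂(gaussianPi n 0 σ2) with hCr
  set S : ℝ := ∫ w, ∑ i, (w i) ^ 2 ∂(gaussianPi n 0 σ2) with hS
  set u : (Fin n → ℝ) → ℝ := fun z => ∑ i, (z i - g z i) ^ 2 with hu
  have hum : Measurable u := by fun_prop
  have hmem : Set.Ioc 0 β ∈ nhdsWithin (0:ℝ) (Set.Ioi 0) := Ioc_mem_nhdsGT hβ
  have mono : ∀ (v : (Fin n → ℝ) → ℝ), MemLp v 2 (gaussianPi n θ ((1 + β) * σ2)) →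
      ∀ α, 0 ≤ α → α ≤ β → MemLp v 2 (gaussianPi n θ ((1 + α) * σ2)) :=
    fun v hv α h0 h1 => MemLp.of_measure_le_smul (by simp) (hK α h0 h1) hv
  have hq : MemLp (fun y => ∑ i, (g y i) ^ 2) 2 (gaussianPi n θ ((1 + β) * σ2)) :=
    (memLp_two_iff_integrable_sq
      (Measurable.aestronglyMeasurable (by fun_prop))).2 hg4
  have hu2 : MemLp u 2 (gaussianPi n θ ((1 + β) * σ2)) := u_memLp θ _ g hg hq
  have hu0 : MemLp u 2 μ := by simpa using mono u hu2 0 le_rfl hβ.le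
  have hCm : ∀ α, StronglyMeasurable (Cr α) := by
    intro α
    have h1 : Measurable (fun p : (Fin n → ℝ) × (Fin n → ℝ) =>
        g (fun j => p.1 j + √α * p.2 j)) := hg.comp (measurable_shift α)
    have : StronglyMeasurable (fun p : (Fin n → ℝ) × (Fin n → ℝ) =>
        ∑ i, p.2 i * g (fun j => p.1 j + √α * p.2 j) i) :=
      Measurable.stronglyMeasurable (by fun_prop)
    exact (this.integral_prod_right (ν := gaussianPi n 0 σ2)).const_mul _
  have hCb : ∀ᵐ y ∂μ, ∀ α ∈ Set.Ioc (0:ℝ) β, (Cr α y) ^ 2 ≤ H y := by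
    filter_upwards [hac.ae_le hdom] with y hy α hα
    refine le_trans (le_of_eq ?_) (hy α hα)
    simp only [hCr]
    rw [mul_pow, div_pow, Real.sq_sqrt hα.1.le]
    norm_num
  have hCl : ∀ᵐ y ∂μ, Tendsto (fun α => Cr α y) (nhdsWithin 0 (Set.Ioi 0)) (nhds (h y)) :=
    hac.ae_le hlim
  have hhb : ∀ᵐ y ∂μ, (h y) ^ 2 ≤ H y := by
    filter_upwards [hCb, hCl] with y h1 h2
    refine le_of_tendsto (h2.pow 2) ?_
    filter_upwards [hmem] with α hα using h1 α hα
  have hhL : MemLp h 2 μ := by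
    rw [memLp_two_iff_integrable_sq hh.aestronglyMeasurable]
    refine hHint.mono' (hh.pow_const 2).aestronglyMeasurable ?_
    filter_upwards [hhb] with y hy
    rwa [Real.norm_eq_abs, abs_of_nonneg (sq_nonneg _)]
  set D : ℝ → (Fin n → ℝ) → ℝ := fun α y => (1 + α) * Cr α y - α * S - h y with hD
  have hDm : ∀ α, StronglyMeasurable (D α) := fun α =>
    (((hCm α).const_mul _).sub stronglyMeasurable_const).sub hh.stronglyMeasurable
  have hDt : Tendsto (fun α => eLpNorm (D α) 2 μ) (nhdsWithin 0 (Set.Ioi 0)) (nhds 0) := by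
    refine eLpNorm_tendsto_of_dom μ _ D
      (fun y => 3 * ((1 + β) ^ 2 * H y + β ^ 2 * S ^ 2 + H y))
      (.of_forall fun α => (hDm α).aestronglyMeasurable) ?_ ?_ ?_
    · filter_upwards [hmem] with α hα
      filter_upwards [hCb, hhb] with y h1 h2
      have h1 := h1 α hα
      have a1 : (1 + α) ^ 2 * Cr α y ^ 2 ≤ (1 + β) ^ 2 * H y := by
        have := hα.1.le
        have := hα.2
        gcongr
      have a2 : α ^ 2 * S ^ 2 ≤ β ^ 2 * S ^ 2 := by
        have := hα.1.le
        have := hα.2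
        gcongr
      have a3 : (D α y) ^ 2 ≤ 3 * ((1 + α) ^ 2 * Cr α y ^ 2 + α ^ 2 * S ^ 2 + h y ^ 2) := by
        simp only [hD]
        nlinarith [sq_nonneg ((1 + α) * Cr α y + α * S), sq_nonneg ((1 + α) * Cr α y + h y),
          sq_nonneg (α * S - h y)]
      linarith
    · exact (((hHint.const_mul _).add (integrable_const _)).add hHint).const_mul _
    · filter_upwards [hCl] with y hy
      have t : Tendsto (fun α : ℝ => α) (nhdsWithin 0 (Set.Ioi 0)) (nhds 0) :=
        tendsto_id.mono_left nhdsWithin_le_nhds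
      have := (((t.const_add 1).mul hy).sub (t.mul_const S)).sub_const (h y)
      simpa using this
  have hform : ∀ α ∈ Set.Ioc (0:ℝ) β, (fun y =>
          ∫ w, ((∑ i, (y i - w i / √α - g (fun j => y j + √α * w j) i) ^ 2)
            - (∑ i, (w i) ^ 2) / α) ∂(gaussianPi n 0 σ2)) =ᵐ[μ]
        gsmooth σ2 α u + D α + h := by
    intro α hα
    filter_upwards [gsmooth_int θ hσ2 hα.1.le ((mono u hu2 α hα.1.le hα.2).integrable (by norm_num)),
      gsmooth_int θ hσ2 hα.1.le ((mono _ hq α hα.1.le hα.2).integrable (by norm_num))] with y h1 h2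
    rw [F_formula σ2 g hg hα.1 y h1 h2]
    simp only [Pi.add_apply, hD, hCr, hS, hu]
    ring
  refine var_tendsto μ _ _ _ (hu0.add hhL) ?_ ?_
  · filter_upwards [hmem] with α hα
    exact ((((gsmooth_sm σ2 α hum).add (hDm α)).add
      hh.stronglyMeasurable).aestronglyMeasurable).congr (hform α hα).symm
  · have hT := (gsmooth_tendsto θ hσ2 hβ hum hu2).add hDt
    rw [add_zero] at hT
    refine tendsto_of_tendsto_of_tendsto_of_le_of_le' tendsto_const_nhds hT
      (.of_forall fun _ => zero_le) ?_
    filter_upwards [hmem] with α hα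
    refine le_trans (le_of_eq ?_) (eLpNorm_add_le (μ := μ)
      ((gsmooth_sm σ2 α hum).sub hum.stronglyMeasurable).aestronglyMeasurable
      (hDm α).aestronglyMeasurable (by norm_num))
    refine eLpNorm_congr_ae ?_
    filter_upwards [hform α hα] with y hy
    simp only [Pi.sub_apply, Pi.add_apply] at hy ⊢
    rw [hy]
    simp only [hu]
    ring
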